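/- Let m ≥ 1, n ≥ 1, N⃗ = (N_1,…,N_K) ∈ I_{K,n}, 1 ≤ j ≤ K, and k⃗ = (k_1,…,k_j) ∈ I_{j,K}. Set p_t = Σ_{k⃗^t < s ≤ k⃗^{t+1}} N_s, so p⃗ = (p_1,…,p_j) ∈ I_{j,n}, and let N⃗_t = (N_s)_{k⃗^t < s ≤ k⃗^{t+1}} ∈ I_{k_t,p_t}. Then for every t ∈ {1,…,j} and every ordered pair (i,i′) with 1 ≤ i < i′ ≤ mn: ρ^{(m)}_{k_t,N⃗_t}(λ^{(m)}_{j,p⃗,t}(i,i′)) = λ^{(m)}_{j,k⃗,t}(ρ^{(m)}_{K,N⃗}(i,i′)). (This is the compatibility of the left and right actions of the associative operad on the divided powers γ_m𝓑 of the choose-two operad.) -/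

import Mathlib

noncomputable section

/-- Partial sum `n⃗^s = n₁ + ⋯ + n_{s−1}` (so `psum nv 1 = 0`). -/
def psum (nv : ℕ → ℕ) (s : ℕ) : ℕ := ∑ i ∈ Finset.Ico 1 s, nv i

/-- The block of `a` with respect to the tuple `nv`: the unique `s ≥ 1` with
`n⃗^s < a ≤ n⃗^{s+1}`, realized as the least `s ≥ 1` with `a ≤ n⃗^{s+1}`. -/
def blk (nv : ℕ → ℕ) (a : ℕ) : ℕ := sInf {s : ℕ | 1 ≤ s ∧ a ≤ psum nv (s + 1)}

/-- The column `a_i ∈ {1,…,n}` of `i ∈ {1,…,mn}`, i.e. the unique `a` with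
`i = (a−1)m + r`, `1 ≤ r ≤ m`. -/
def col (m i : ℕ) : ℕ := (i - 1) / m + 1

/-- The row `r_i ∈ {1,…,m}` of `i ∈ {1,…,mn}`. -/
def row (m i : ℕ) : ℕ := (i - 1) % m + 1

/-- `ι_r(i) = (i−1)m + r`. -/
def iot (m r i : ℕ) : ℕ := (i - 1) * m + r

/-- The right-action map `ρ^{(m)}_{k,n⃗}` on ordered pairs, with basepoint `+ = none`:
`ρ^{(m)}_{k,n⃗}(i,j) = ((s−1)m+r, (t−1)m+r)` if the block `s` of `a_i` is strictly smaller
than the block `t` of `a_j` and `r_i = r_j = r`; otherwise `+`. -/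
def rho (m : ℕ) (nv : ℕ → ℕ) (ij : ℕ × ℕ) : Option (ℕ × ℕ) :=
  if blk nv (col m ij.1) < blk nv (col m ij.2) ∧ row m ij.1 = row m ij.2 then
    some ((blk nv (col m ij.1) - 1) * m + row m ij.1,
          (blk nv (col m ij.2) - 1) * m + row m ij.1)
  else none

/-- The `s`-th component `λ^{(m)}_{k,n⃗,s}` of the left-action map, with basepoint `+ = none`:
`λ^{(m)}_{k,n⃗,s}(i,j) = ((a_i − n⃗^s − 1)m + r, (a_j − n⃗^s − 1)m + r)` if
`n⃗^s < a_i < a_j ≤ n⃗^{s+1}` and `r_i = r_j = r`; otherwise `+`. -/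
def lam (m : ℕ) (nv : ℕ → ℕ) (s : ℕ) (ij : ℕ × ℕ) : Option (ℕ × ℕ) :=
  if psum nv s < col m ij.1 ∧ col m ij.1 < col m ij.2 ∧ col m ij.2 ≤ psum nv (s + 1)
      ∧ row m ij.1 = row m ij.2 then
    some ((col m ij.1 - psum nv s - 1) * m + row m ij.1,
          (col m ij.2 - psum nv s - 1) * m + row m ij.1)
  else none

end

theorem psum_mono (nv : ℕ → ℕ) : Monotone (psum nv) := fun _ _ h =>
  Finset.sum_le_sum_of_subset (Finset.Ico_subset_Ico_right h)

theorem psum_one (nv : ℕ → ℕ) : psum nv 1 = 0 := by simp [psum]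

theorem psum_succ (nv : ℕ → ℕ) {s : ℕ} (hs : 1 ≤ s) : psum nv (s + 1) = psum nv s + nv s :=
  Finset.sum_Ico_succ_top hs nv

theorem psum_shift (nv : ℕ → ℕ) (c u : ℕ) :
    psum nv (c + u + 1) = psum nv (c + 1) + psum (fun s => nv (c + s)) (u + 1) := by
  induction u with
  | zero => simp [psum_one]
  | succ u ih =>
    rw [psum_succ (fun s => nv (c + s)) (Nat.le_add_left 1 u),
      psum_succ nv (by omega : 1 ≤ c + (u + 1)), ← add_assoc c u 1, ih]
    ring_nf

/-- Grouping the entries of a tuple into consecutive runs groups its partial sums. -/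
theorem psum_grouped {nv kv pv : ℕ → ℕ}
    (hpv : ∀ t, pv t = ∑ s ∈ Finset.Ioc (psum kv t) (psum kv (t + 1)), nv s)
    {t : ℕ} (ht : 1 ≤ t) : psum pv t = psum nv (psum kv t + 1) := by
  induction t, ht using Nat.le_induction with
  | base => simp [psum_one]
  | succ t ht ih =>
    have hmono : psum kv t ≤ psum kv (t + 1) := psum_mono kv t.le_succ
    have hIoc : Finset.Ioc (psum kv t) (psum kv (t + 1)) =
        Finset.Ico (psum kv t + 1) (psum kv (t + 1) + 1) := by
      ext x
      simp only [Finset.mem_Ioc, Finset.mem_Ico]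
      omega
    rw [psum_succ pv ht, ih, hpv, hIoc]
    exact Finset.sum_Ico_consecutive nv (by omega) (by omega)

theorem blk_mem {nv : ℕ → ℕ} {a S : ℕ} (ha : 1 ≤ a) (hS : a ≤ psum nv (S + 1)) :
    1 ≤ blk nv a ∧ a ≤ psum nv (blk nv a + 1) := by
  refine Nat.sInf_mem (s := {s : ℕ | 1 ≤ s ∧ a ≤ psum nv (s + 1)}) ⟨S, ?_, hS⟩
  rcases Nat.eq_zero_or_pos S with rfl | h
  · rw [zero_add, psum_one] at hS
    omega
  · exact h

/-- `blk nv` is left adjoint to the partial sums, on positive elements within range. -/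
theorem blk_le_iff {nv : ℕ → ℕ} {a S : ℕ} (ha : 1 ≤ a) (hS : a ≤ psum nv (S + 1)) (u : ℕ) :
    blk nv a ≤ u ↔ a ≤ psum nv (u + 1) := by
  refine ⟨fun h => (blk_mem ha hS).2.trans (psum_mono nv (by omega)), fun h => ?_⟩
  refine Nat.sInf_le ⟨?_, h⟩
  rcases Nat.eq_zero_or_pos u with rfl | hu
  · rw [zero_add, psum_one] at h
    omega
  · exact hu

theorem blk_shift {nv : ℕ → ℕ} {a c S : ℕ} (hc : psum nv (c + 1) < a)
    (hS : a ≤ psum nv (S + 1)) :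
    blk nv a = c + blk (fun s => nv (c + s)) (a - psum nv (c + 1)) := by
  have hcS : c ≤ S := by
    by_contra! h
    have := psum_mono nv (by omega : S + 1 ≤ c + 1)
    omega
  obtain ⟨v, rfl⟩ := Nat.exists_eq_add_of_le hcS
  have hv : a - psum nv (c + 1) ≤ psum (fun s => nv (c + s)) (v + 1) := by
    have := psum_shift nv c v
    omega
  refine eq_of_forall_ge_iff fun u => ?_
  rw [blk_le_iff (by omega) hS]
  rcases le_or_gt c u with h | h
  · obtain ⟨w, rfl⟩ := Nat.exists_eq_add_of_le h
    rw [add_le_add_iff_left, blk_le_iff (by omega) hv, psum_shift]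
    omega
  · have := psum_mono nv (by omega : u + 1 ≤ c + 1)
    omega

theorem row_pos (m i : ℕ) : 1 ≤ row m i := Nat.le_add_left 1 _

theorem row_le {m : ℕ} (hm : 1 ≤ m) (i : ℕ) : row m i ≤ m := Nat.mod_lt _ hm

theorem col_le {m n i : ℕ} (hi : 1 ≤ i) (h : i ≤ m * n) : col m i ≤ n :=
  Nat.div_lt_of_lt_mul (by omega)

theorem col_mul_add {m r : ℕ} (hr : 1 ≤ r) (hrm : r ≤ m) {s : ℕ} (hs : 1 ≤ s) :
    col m ((s - 1) * m + r) = s := by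
  rw [col, Nat.add_sub_assoc hr, add_comm (_ * _), Nat.add_mul_div_right _ _ (by omega),
    Nat.div_eq_of_lt (by omega)]
  omega

theorem row_mul_add {m r : ℕ} (hr : 1 ≤ r) (hrm : r ≤ m) (s : ℕ) :
    row m (s * m + r) = r := by
  rw [row, Nat.add_sub_assoc hr, add_comm (_ * _), Nat.add_mul_mod_self_right,
    Nat.mod_eq_of_lt (by omega)]
  omega

/-- compatibility of the left and right actions of the associative operad on
the divided powers `γ_m𝓑` of the choose-two operad: for `N⃗ ∈ I_{K,n}`, `k⃗ ∈ I_{j,K}`,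
`p_t = Σ_{k⃗^t < s ≤ k⃗^{t+1}} N_s` and `N⃗_t = (N_s)_{k⃗^t < s ≤ k⃗^{t+1}}`,
`ρ^{(m)}_{k_t,N⃗_t} ∘ λ^{(m)}_{j,p⃗,t} = λ^{(m)}_{j,k⃗,t} ∘ ρ^{(m)}_{K,N⃗}`. -/
theorem stmt4 (m n K j : ℕ) (hm : 1 ≤ m) (hn : 1 ≤ n)
    (hK1 : 1 ≤ K) (hKn : K ≤ n)
    (Nv : ℕ → ℕ) (hNv : ∑ s ∈ Finset.Icc 1 K, Nv s = n)
    (hj1 : 1 ≤ j) (hjK : j ≤ K)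
    (kv : ℕ → ℕ) (hkv : ∑ t ∈ Finset.Icc 1 j, kv t = K)
    (pv : ℕ → ℕ)
    (hpv : ∀ t, pv t = ∑ s ∈ Finset.Ioc (psum kv t) (psum kv (t + 1)), Nv s) :
    ∀ t, 1 ≤ t → t ≤ j →
      ∀ i i' : ℕ, 1 ≤ i → i < i' → i' ≤ m * n →
        Option.bind (lam m pv t (i, i')) (fun p => rho m (fun s => Nv (psum kv t + s)) p)
          = Option.bind (rho m Nv (i, i')) (fun p => lam m kv t p) := by
  intro t ht htj i i' hi hii' hi'
  have hn_eq : psum Nv (K + 1) = n := hNv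
  have ha1 : 1 ≤ col m i := Nat.le_add_left 1 _
  have hb1 : 1 ≤ col m i' := Nat.le_add_left 1 _
  have haS : col m i ≤ psum Nv (K + 1) := hn_eq ▸ col_le hi (by omega)
  have hbS : col m i' ≤ psum Nv (K + 1) := hn_eq ▸ col_le (by omega) hi'
  have hr1 := row_pos m i
  have hrm := row_le hm i
  have hA := blk_mem ha1 haS
  have hB := blk_mem hb1 hbS
  have hlt := blk_le_iff ha1 haS (psum kv t)
  have hle := blk_le_iff hb1 hbS (psum kv (t + 1))
  have hba := blk_le_iff hb1 hbS (blk Nv (col m i))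
  have hPt := psum_grouped hpv ht
  have hPt' : psum pv (t + 1) = psum Nv (psum kv (t + 1) + 1) :=
    psum_grouped hpv (Nat.le_succ_of_le ht)
  by_cases hrow : row m i = row m i'
  swap
  · simp [lam, rho, hrow]
  by_cases hin : psum pv t < col m i ∧ col m i < col m i' ∧ col m i' ≤ psum pv (t + 1)
  · obtain ⟨h1, h2, h3⟩ := hin
    have hsa := blk_shift (hPt ▸ h1) haS
    have hsb := blk_shift (hPt ▸ h1.trans h2) hbS
    rw [← hPt] at hsa hsb
    have hL : lam m pv t (i, i') = some ((col m i - psum pv t - 1) * m + row m i,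
        (col m i' - psum pv t - 1) * m + row m i) := if_pos ⟨h1, h2, h3, hrow⟩
    rw [hL, Option.bind_some]
    simp only [rho, col_mul_add hr1 hrm (by omega : 1 ≤ col m i - psum pv t),
      col_mul_add hr1 hrm (by omega : 1 ≤ col m i' - psum pv t), row_mul_add hr1 hrm]
    by_cases hblk : blk Nv (col m i) < blk Nv (col m i')
    · rw [if_pos ⟨by omega, trivial⟩, if_pos ⟨hblk, hrow⟩, Option.bind_some]
      simp only [lam, col_mul_add hr1 hrm hA.1, col_mul_add hr1 hrm hB.1, row_mul_add hr1 hrm]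
      rw [if_pos ⟨by omega, hblk, by omega, trivial⟩, hsa, hsb, Nat.add_sub_cancel_left,
        Nat.add_sub_cancel_left]
    · rw [if_neg (fun h => hblk (by omega)), if_neg (by tauto), Option.bind_none]
  · have hL : lam m pv t (i, i') = none := if_neg (by tauto)
    rw [hL, Option.bind_none]
    by_cases hblk : blk Nv (col m i) < blk Nv (col m i')
    · have hR : rho m Nv (i, i') = some ((blk Nv (col m i) - 1) * m + row m i,
          (blk Nv (col m i') - 1) * m + row m i) := if_pos ⟨hblk, hrow⟩
      rw [hR, Option.bind_some]
      simp only [lam, col_mul_add hr1 hrm hA.1, col_mul_add hr1 hrm hB.1, row_mul_add hr1 hrm]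
      rw [if_neg]
      rintro ⟨h1, -, h3, -⟩
      exact hin ⟨by omega, by omega, by omega⟩
    · have hR : rho m Nv (i, i') = none := if_neg (by tauto)
      rw [hR, Option.bind_none]
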